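/- For every n ≥ 1 and k ≥ 1, as an identity of polynomials in z: n! · Σ_{T ∈ T_k(n)} ∏_{v ∈ T} (z + (k-1)h_v)^{h_v - 1} / [k·h_v·(kz + (k-1)(h_v - 1))^{h_v - 2}] = z·(z + (k-1)n)^{n-1}. -/

import Mathlib

/-- `k`-ary trees: each vertex has `k` linearly ordered (possibly empty) subtrees. -/
inductive KTree (k : ℕ) : Type
  | leaf : KTree k
  | node : (Fin k → KTree k) → KTree k

namespace KTree

/-- The number of vertices of a `k`-ary tree. -/
def size {k : ℕ} : KTree k → ℕ
  | leaf => 0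
  | node c => (∑ i, size (c i)) + 1

/-- The multiset of hook lengths of a `k`-ary tree: the hook length of a vertex
is the number of its descendants, counting the vertex itself. -/
def hooks {k : ℕ} : KTree k → Multiset ℕ+
  | leaf => 0
  | node c => ⟨(∑ i, size (c i)) + 1, Nat.succ_pos _⟩ ::ₘ ∑ i, hooks (c i)

end KTree

namespace KTree

theorem finite_size_le (k n : ℕ) : {t : KTree k | t.size ≤ n}.Finite := by
  induction n with
  | zero =>
    refine (Set.finite_singleton leaf).subset ?_
    rintro (_ | c) h
    · rfl
    · simp [size] at h
  | succ n ih =>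
    refine (((Set.Finite.pi fun _ : Fin k => ih).image node).insert leaf).subset ?_
    rintro (_ | c) h
    · exact Set.mem_insert _ _
    · refine Set.mem_insert_of_mem _ ⟨c, fun i _ => ?_, rfl⟩
      have hi : (c i).size ≤ ∑ j, (c j).size :=
        Finset.single_le_sum (f := fun j => (c j).size) (fun _ _ => Nat.zero_le _)
          (Finset.mem_univ i)
      simp only [Set.mem_ofPred_eq, size] at h ⊢
      omega

theorem finite_size_eq (k n : ℕ) : {t : KTree k | t.size = n}.Finite :=
  (finite_size_le k n).subset fun _ h => le_of_eq h

/-- The finite set of `k`-ary trees with `n` vertices. -/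
noncomputable def ofSize (k n : ℕ) : Finset (KTree k) :=
  (finite_size_eq k n).toFinset

@[simp]
theorem mem_ofSize {k n : ℕ} {t : KTree k} : t ∈ ofSize k n ↔ t.size = n := by
  simp [ofSize]

theorem ofSize_zero (k : ℕ) : ofSize k 0 = {leaf} := by
  ext (_ | c) <;> simp [size]

variable {R : Type*} [CommSemiring R]

/-- The product of the weights of the hook lengths of a tree. -/
def hookProd {k : ℕ} (w : ℕ+ → R) (t : KTree k) : R := (t.hooks.map w).prod

theorem hookProd_leaf {k : ℕ} (w : ℕ+ → R) : hookProd w (leaf : KTree k) = 1 := by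
  simp [hookProd, hooks]

theorem hookProd_node {k : ℕ} (w : ℕ+ → R) (c : Fin k → KTree k) :
    hookProd w (node c) = w (∑ i, (c i).size).succPNat * ∏ i, hookProd w (c i) := by
  have hnode : (node c).hooks = (∑ i, (c i).size).succPNat ::ₘ ∑ i, (c i).hooks := rfl
  simp only [hookProd, hnode, Multiset.map_cons, Multiset.prod_cons]
  congr 1
  have h := map_sum (Multiset.mapAddMonoidHom w) (fun i => (c i).hooks) Finset.univ
  simp only [Multiset.coe_mapAddMonoidHom] at h
  rw [h, Multiset.prod_sum]

/-- Decomposing trees at the root expresses the hook sums of size `n + 1` through those of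
smaller size. -/
theorem sum_hookProd_succ (k : ℕ) (w : ℕ+ → R) (n : ℕ) :
    ∑ t ∈ ofSize k (n + 1), hookProd w t =
      w n.succPNat * ∑ l ∈ Finset.finsuppAntidiag (Finset.univ : Finset (Fin k)) n,
        ∏ i, ∑ t ∈ ofSize k (l i), hookProd w t := by
  classical
  simp_rw [Finset.prod_univ_sum]
  rw [Finset.sum_sigma', Finset.mul_sum]
  symm
  refine Finset.sum_bij (fun p _ => node p.2) ?_ ?_ ?_ ?_
  · rintro ⟨l, c⟩ h
    simp only [Finset.mem_sigma, Finset.mem_finsuppAntidiag, Fintype.mem_piFinset,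
      mem_ofSize] at h
    simp [size, h.2, h.1.1]
  · rintro ⟨l, c⟩ h ⟨l', c'⟩ h' heq
    simp only [Finset.mem_sigma, Fintype.mem_piFinset, mem_ofSize] at h h'
    obtain rfl : c = c' := node.inj heq
    obtain rfl : l = l' := Finsupp.ext fun i => (h.2 i).symm.trans (h'.2 i)
    rfl
  · rintro (_ | c) h
    · simp [size] at h
    · refine ⟨⟨Finsupp.equivFunOnFinite.symm fun i => (c i).size, c⟩, ?_, rfl⟩
      simpa [Finset.mem_finsuppAntidiag, size] using h
  · rintro ⟨l, c⟩ h
    simp only [Finset.mem_sigma, Finset.mem_finsuppAntidiag, Fintype.mem_piFinset,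
      mem_ofSize] at h
    simp [hookProd_node, h.2, h.1.1]

end KTree

section Abel

open Polynomial

variable {K : Type*} [Field K]

/-- The normalized Abel polynomials `X (X + a n) ^ (n - 1) / n!`. -/
noncomputable def abelPoly (a : K) : ℕ → K[X]
  | 0 => 1
  | n + 1 => C ((n + 1).factorial : K)⁻¹ * X * (X + C (a * (n + 1))) ^ n

theorem eval_zero_abelPoly_succ (a : K) (n : ℕ) : (abelPoly a (n + 1)).eval 0 = 0 := by
  simp [abelPoly]

theorem factorial_mul_eval_abelPoly [CharZero K] (a : K) {x : K} (hx : x ≠ 0) (n : ℕ) :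
    (n.factorial : K) * (abelPoly a n).eval x = x * (x + a * n) ^ ((n : ℤ) - 1) := by
  cases n with
  | zero => simp [abelPoly, hx]
  | succ n =>
    have h : ((n + 1).factorial : K) ≠ 0 := Nat.cast_ne_zero.2 (Nat.factorial_ne_zero _)
    simp only [abelPoly, eval_mul, eval_C, eval_X, eval_pow, eval_add, Nat.cast_add, Nat.cast_one,
      add_sub_cancel_right, zpow_natCast]
    field_simp

theorem derivative_abelPoly_succ [CharZero K] (a : K) (n : ℕ) :
    derivative (abelPoly a (n + 1)) = (abelPoly a n).comp (X + C a) := by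
  cases n with
  | zero => simp [abelPoly]
  | succ n =>
    have h : C ((n + 1).factorial : K)⁻¹ = C ((n + 2).factorial : K)⁻¹ * ((n : K[X]) + 2) := by
      have hn : (n : K) + 2 ≠ 0 := by exact_mod_cast (n + 1).succ_ne_zero
      have hf : ((n + 1).factorial : K) ≠ 0 := Nat.cast_ne_zero.2 (Nat.factorial_ne_zero _)
      have : (n : K[X]) + 2 = C ((n : K) + 2) := by simp [C_ofNat]
      rw [this, ← C_mul, Nat.factorial_succ (n + 1)]
      congr 1
      push_cast
      rw [show (n : K) + 1 + 1 = n + 2 by ring]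
      field_simp
    simp only [abelPoly, derivative_mul, derivative_C, derivative_X, derivative_pow,
      derivative_add, mul_comp, C_comp, X_comp, pow_comp, add_comp, h, C_add, C_mul, map_natCast,
      map_one, natCast_comp, one_comp, ofNat_comp, derivative_natCast, derivative_one,
      Nat.cast_add, Nat.cast_one, Nat.add_sub_cancel]
    ring

theorem Polynomial.eq_of_derivative_eq_of_eval_zero_eq [CharZero K] {p q : K[X]}
    (h : derivative p = derivative q) (h0 : p.eval 0 = q.eval 0) : p = q := by
  have hd : derivative (p - q) = 0 := by rw [derivative_sub, h, sub_self]
  have hc := eq_C_of_natDegree_eq_zero (derivative_eq_zero.1 hd)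
  rw [coeff_zero_eq_eval_zero, eval_sub, h0, sub_self, C_0] at hc
  exact sub_eq_zero.1 hc

/-- The Abel polynomials are of binomial type. -/
theorem sum_antidiagonal_abelPoly [CharZero K] (a y : K) (n : ℕ) :
    ∑ p ∈ Finset.HasAntidiagonal.antidiagonal n, abelPoly a p.1 * C ((abelPoly a p.2).eval y) =
      (abelPoly a n).comp (X + C y) := by
  induction n with
  | zero => simp [abelPoly]
  | succ n ih =>
    rw [Finset.Nat.antidiagonal_succ, Finset.sum_cons, Finset.sum_map]
    apply Polynomial.eq_of_derivative_eq_of_eval_zero_eq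
    · have h := congrArg (fun p => p.comp (X + C a)) ih
      simp only [Polynomial.sum_comp, mul_comp, C_comp] at h
      simp [abelPoly.eq_1, derivative_comp, derivative_abelPoly_succ, h, comp_assoc,
        add_right_comm]
    · simp [eval_finsetSum, eval_zero_abelPoly_succ, abelPoly.eq_1]

/-- The exponential generating function of the Abel polynomials. -/
noncomputable def abelSeries (a x : K) : PowerSeries K :=
  PowerSeries.mk fun n => (abelPoly a n).eval x

theorem abelSeries_zero (a : K) : abelSeries a 0 = 1 := by
  ext (_ | n)
  · simp [abelSeries, abelPoly]
  · simp [abelSeries, eval_zero_abelPoly_succ, PowerSeries.coeff_one]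

theorem abelSeries_add [CharZero K] (a x y : K) :
    abelSeries a (x + y) = abelSeries a x * abelSeries a y := by
  ext n
  have h := congrArg (eval x) (sum_antidiagonal_abelPoly a y n)
  simpa [abelSeries, PowerSeries.coeff_mul, eval_finsetSum] using h.symm

theorem abelSeries_natCast_mul [CharZero K] (a x : K) (k : ℕ) :
    abelSeries a (k * x) = abelSeries a x ^ k := by
  induction k with
  | zero => simp [abelSeries_zero]
  | succ k ih => rw [Nat.cast_succ, add_one_mul, abelSeries_add, ih, pow_succ]

theorem sum_finsuppAntidiag_prod_abelPoly [CharZero K] (a x : K) (k n : ℕ) :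
    ∑ l ∈ Finset.finsuppAntidiag (Finset.univ : Finset (Fin k)) n,
        ∏ i, (abelPoly a (l i)).eval x = (abelPoly a n).eval (k * x) := by
  have h := PowerSeries.coeff_prod (fun _ : Fin k => abelSeries a x) n Finset.univ
  rw [Finset.prod_const, Finset.card_univ, Fintype.card_fin, ← abelSeries_natCast_mul] at h
  simpa [abelSeries] using h.symm

theorem KTree.sum_hookProd_eq_eval_abelPoly [CharZero K] (k : ℕ) (a x : K) (w : ℕ+ → K)
    (hw : ∀ n : ℕ, w n.succPNat * (abelPoly a n).eval (k * x) = (abelPoly a (n + 1)).eval x)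
    (n : ℕ) : ∑ t ∈ KTree.ofSize k n, KTree.hookProd w t = (abelPoly a n).eval x := by
  induction n using Nat.strong_induction_on with
  | _ n ih =>
    cases n with
    | zero => simp [KTree.ofSize_zero, KTree.hookProd_leaf, abelPoly]
    | succ n =>
      rw [KTree.sum_hookProd_succ, ← hw, ← sum_finsuppAntidiag_prod_abelPoly]
      congr 1
      refine Finset.sum_congr rfl fun l hl => Finset.prod_congr rfl fun i _ => ih _ ?_
      rw [Finset.mem_finsuppAntidiag] at hl
      have : l i ≤ ∑ j, l j :=
        Finset.single_le_sum (fun _ _ => Nat.zero_le _) (Finset.mem_univ i)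
      have : ∑ j, l j = n := hl.1
      omega

end Abel

theorem RatFunc.natCast_mul_X_add_C_ne_zero {k : ℕ} (hk : 1 ≤ k) (c : ℚ) :
    (k : RatFunc ℚ) * RatFunc.X + RatFunc.C c ≠ 0 := by
  intro h
  have hp : algebraMap (Polynomial ℚ) (RatFunc ℚ)
      (Polynomial.C (k : ℚ) * Polynomial.X + Polynomial.C c) = 0 := by
    simpa using h
  rw [map_eq_zero_iff _ (RatFunc.algebraMap_injective ℚ)] at hp
  have := congrArg (fun p => Polynomial.coeff p 1) hp
  simp at this
  omega

/-- The Abel-type hook length formula for `k`-ary trees, as an identity in `ℚ(z)`. -/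
theorem abel_hook_formula_kary (k n : ℕ) (hk : 1 ≤ k) (hn : 1 ≤ n) :
    letI K := RatFunc ℚ
    letI z : K := RatFunc.X
    (n.factorial : K) *
      ∑ᶠ T : {t : KTree k // t.size = n},
        ((T : KTree k).hooks.map fun h =>
          (z + ((k : K) - 1) * ((h : ℕ) : K)) ^ ((h : ℕ) - 1) /
          ((k : K) * ((h : ℕ) : K) *
            ((k : K) * z + ((k : K) - 1) * (((h : ℕ) : K) - 1)) ^ (((h : ℕ) : ℤ) - 2))).prod
    = z * (z + ((k : K) - 1) * (n : K)) ^ (n - 1) := by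
  have hk0 : (k : RatFunc ℚ) ≠ 0 := Nat.cast_ne_zero.2 (by omega)
  have hX : (RatFunc.X : RatFunc ℚ) ≠ 0 := RatFunc.X_ne_zero
  have hd (m : ℕ) : (k : RatFunc ℚ) * RatFunc.X + ((k : RatFunc ℚ) - 1) * (m : RatFunc ℚ) ≠ 0 := by
    simpa using RatFunc.natCast_mul_X_add_C_ne_zero hk (((k : ℚ) - 1) * m)
  let W (h : ℕ) : RatFunc ℚ := (RatFunc.X + ((k : RatFunc ℚ) - 1) * (h : RatFunc ℚ)) ^ (h - 1) /
    ((k : RatFunc ℚ) * (h : RatFunc ℚ) *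
      ((k : RatFunc ℚ) * RatFunc.X + ((k : RatFunc ℚ) - 1) * ((h : RatFunc ℚ) - 1)) ^ ((h : ℤ) - 2))
  have hW (m : ℕ) : W m.succPNat *
      (abelPoly ((k : RatFunc ℚ) - 1) m).eval ((k : RatFunc ℚ) * RatFunc.X) =
      (abelPoly ((k : RatFunc ℚ) - 1) (m + 1)).eval RatFunc.X := by
    have hf : (m.factorial : RatFunc ℚ) ≠ 0 := Nat.cast_ne_zero.2 (Nat.factorial_ne_zero _)
    have hm : (m : RatFunc ℚ) + 1 ≠ 0 := by exact_mod_cast m.succ_ne_zero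
    have hpow := zpow_ne_zero ((m : ℤ) - 1) (hd m)
    have h1 := factorial_mul_eval_abelPoly ((k : RatFunc ℚ) - 1) (mul_ne_zero hk0 hX) m
    have h2 := factorial_mul_eval_abelPoly ((k : RatFunc ℚ) - 1) hX (m + 1)
    rw [mul_comm, ← eq_div_iff hf] at h1
    rw [Nat.factorial_succ, Nat.cast_mul, mul_comm,
      ← eq_div_iff (mul_ne_zero (Nat.cast_ne_zero.2 m.succ_ne_zero) hf)] at h2
    rw [h1, h2]
    simp only [W, Nat.succPNat_coe, Nat.succ_eq_add_one, Nat.cast_add, Nat.cast_one,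
      add_sub_cancel_right, Nat.add_sub_cancel, zpow_natCast]
    rw [show (m : ℤ) + 1 - 2 = m - 1 by ring]
    generalize ((k : RatFunc ℚ) * RatFunc.X + ((k : RatFunc ℚ) - 1) * (m : RatFunc ℚ)) ^
      ((m : ℤ) - 1) = D at hpow ⊢
    field_simp
  have hsum := finsum_set_coe_eq_finsum_mem {t : KTree k | t.size = n}
    (f := KTree.hookProd fun h : ℕ+ => W h)
  rw [finsum_mem_eq_finite_toFinset_sum _ (KTree.finite_size_eq k n)] at hsum
  have h := factorial_mul_eval_abelPoly ((k : RatFunc ℚ) - 1) hX n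
  rw [← Nat.cast_pred hn, zpow_natCast] at h
  simp only [Multiset.bind_def, Multiset.pure_def, Multiset.bind_singleton, Multiset.map_map]
  exact (congrArg _ (hsum.trans
    (KTree.sum_hookProd_eq_eval_abelPoly k _ _ (fun h : ℕ+ => W h) hW n))).trans h
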